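/- arXiv:2412.10551 — 2 statements merged into one kernel-verified Lean document; each statement's English description precedes it below -/
import Mathlib

section
/- Assume the background is constant, q_+ = q_−. Let 0 < ε < 1, let C₃, C₅, C₆ be positive constants, and let U, V : [0,T_c] → ℓ²(ℤ;ℂ) be continuously differentiable solutions of the modified Ablowitz–Ladik equation and the modified discrete nonlinear Schrödinger equation, respectively, such that ‖U(0) − V(0)‖_{ℓ²} ≤ C₃ε³, ‖U(t)‖_{ℓ²} ≤ C₅ε and ‖V(t)‖_{ℓ²} ≤ C₆ε for all t ∈ [0,T_c]. Then for all t ∈ [0,T_c], ‖U(t) − V(t)‖_{ℓ²} ≤ C₃ε³ + [ (2C₅³ + C₆³)ε³ + (6C₅² + 3C₆²) q ε² + (8C₅ + 4C₆) q² ε ] · t. -/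
noncomputable section

/-- The space `ℓ²(ℤ;ℂ)` of square-summable complex sequences. -/
abbrev l2Z : Type := lp (fun _ : ℤ => ℂ) 2

/-- Discrete Laplacian `(Δ_d u)_n = u_{n+1} - 2 u_n + u_{n-1}`. -/
def discLap (u : ℤ → ℂ) (n : ℤ) : ℂ := u (n + 1) - 2 * u n + u (n - 1)

/-- The step background: `q_n = q_-` for `n ≤ 0` and `q_n = q_+` for `n ≥ 1`. -/
def stepBg (qm qp : ℂ) (n : ℤ) : ℂ := if n ≤ 0 then qm else qp

/-- The ℓ² norm `(Σ_{n ∈ ℤ} |f n|²)^{1/2}` of a complex sequence. -/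
def l2norm (f : ℤ → ℂ) : ℝ := Real.sqrt (∑' n : ℤ, ‖f n‖ ^ 2)

/-- Ablowitz–Ladik nonlinearity
`F_AL(U)_n = -2q²(U_n+q_n) + |U_n+q_n|²(U_{n+1}+U_{n-1}+q_{n+1}+q_{n-1})`. -/
def F_AL (q : ℝ) (qm qp : ℂ) (U : ℤ → ℂ) (n : ℤ) : ℂ :=
  -(2 * (q : ℂ) ^ 2) * (U n + stepBg qm qp n)
    + (‖U n + stepBg qm qp n‖ : ℂ) ^ 2
      * (U (n + 1) + U (n - 1) + stepBg qm qp (n + 1) + stepBg qm qp (n - 1))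

/-- DNLS nonlinearity `F_DNLS(V)_n = 2(|V_n+q_n|² - q²)(V_n+q_n)`. -/
def F_DNLS (q : ℝ) (qm qp : ℂ) (V : ℤ → ℂ) (n : ℤ) : ℂ :=
  2 * ((‖V n + stepBg qm qp n‖ : ℂ) ^ 2 - (q : ℂ) ^ 2) * (V n + stepBg qm qp n)

/-- `U` is a continuously differentiable `ℓ²`-valued solution of the modified
Ablowitz–Ladik equation `i U̇_n + κ(Δ_d U)_n + κ(Δ_d q)_n + F_AL(U)_n = 0` on `[0,T]`. -/
def IsModALSol (κ q : ℝ) (qm qp : ℂ) (T : ℝ) (U : ℝ → l2Z) : Prop :=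
  ∃ U' : ℝ → l2Z,
    ContinuousOn U' (Set.Icc 0 T) ∧
    (∀ t ∈ Set.Icc (0:ℝ) T, HasDerivWithinAt U (U' t) (Set.Icc 0 T) t) ∧
    (∀ t ∈ Set.Icc (0:ℝ) T, ∀ n : ℤ,
      Complex.I * U' t n + (κ : ℂ) * discLap (⇑(U t)) n
        + (κ : ℂ) * discLap (stepBg qm qp) n + F_AL q qm qp (⇑(U t)) n = 0)

/-- `V` is a continuously differentiable `ℓ²`-valued solution of the modified
DNLS equation `i V̇_n + κ(Δ_d V)_n + κ(Δ_d q)_n + F_DNLS(V)_n = 0` on `[0,T]`. -/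
def IsModDNLSSol (κ q : ℝ) (qm qp : ℂ) (T : ℝ) (V : ℝ → l2Z) : Prop :=
  ∃ V' : ℝ → l2Z,
    ContinuousOn V' (Set.Icc 0 T) ∧
    (∀ t ∈ Set.Icc (0:ℝ) T, HasDerivWithinAt V (V' t) (Set.Icc 0 T) t) ∧
    (∀ t ∈ Set.Icc (0:ℝ) T, ∀ n : ℤ,
      Complex.I * V' t n + (κ : ℂ) * discLap (⇑(V t)) n
        + (κ : ℂ) * discLap (stepBg qm qp) n + F_DNLS q qm qp (⇑(V t)) n = 0)

open scoped ComplexConjugate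

namespace l2Z

theorem hasSum_norm_sq (f : l2Z) : HasSum (fun n => ‖f n‖ ^ 2) (‖f‖ ^ 2) := by
  simpa using lp.hasSum_norm (p := 2) (by norm_num) f

theorem norm_apply_le (f : l2Z) (n : ℤ) : ‖f n‖ ≤ ‖f‖ :=
  lp.norm_apply_le_norm (by norm_num) f n

/-- The square-norms of three consecutive entries sum to at most the square of the `ℓ²` norm. -/
theorem norm_sq_neighbors_le (f : l2Z) (n : ℤ) :
    ‖f n‖ ^ 2 + ‖f (n + 1)‖ ^ 2 + ‖f (n - 1)‖ ^ 2 ≤ ‖f‖ ^ 2 := by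
  have h := sum_le_hasSum ({n, n + 1, n - 1} : Finset ℤ) (fun i _ => sq_nonneg ‖f i‖)
    f.hasSum_norm_sq
  rw [Finset.sum_insert (by simp; omega), Finset.sum_insert (by simp; omega),
    Finset.sum_singleton] at h
  linarith

/-- A sequence dominated pointwise by a multiple of an `ℓ²` sequence is itself in `ℓ²`. -/
theorem exists_coe_eq_of_norm_le (f : ℤ → ℂ) (g : l2Z) {C : ℝ} (hC : 0 ≤ C)
    (h : ∀ n, ‖f n‖ ≤ C * ‖g n‖) : ∃ F : l2Z, (∀ n, F n = f n) ∧ ‖F‖ ≤ C * ‖g‖ := by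
  have h' : ∀ n, ‖f n‖ ≤ ‖((C : ℂ) • g) n‖ := fun n => by
    rw [lp.coeFn_smul, Pi.smul_apply, norm_smul, Complex.norm_real, Real.norm_of_nonneg hC]
    exact h n
  refine ⟨⟨f, (lp.memℓp ((C : ℂ) • g)).mono' h'⟩, fun _ => rfl, ?_⟩
  calc _ ≤ ‖(C : ℂ) • g‖ := lp.norm_mono (by norm_num) h'
    _ = C * ‖g‖ := by rw [norm_smul]; simp [abs_of_nonneg hC]

/-- Translation of an `ℓ²` sequence. -/
def shift (k : ℤ) (g : l2Z) : l2Z :=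
  ⟨fun n => g (n + k), memℓp_gen <| by
    simpa [Function.comp_def] using (Equiv.addRight k).summable_iff.2 g.hasSum_norm_sq.summable⟩

@[simp] theorem shift_apply (k : ℤ) (g : l2Z) (n : ℤ) : shift k g n = g (n + k) := rfl

theorem norm_shift (k : ℤ) (g : l2Z) : ‖shift k g‖ = ‖g‖ := by
  have h := (Equiv.addRight k).hasSum_iff.2 g.hasSum_norm_sq
  have h' := (shift k g).hasSum_norm_sq.unique h
  exact (pow_left_inj₀ (norm_nonneg _) (norm_nonneg _) two_ne_zero).1 h'

theorem inner_shift (k : ℤ) (f g : l2Z) :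
    inner ℂ f (shift k g) = inner ℂ (shift (-k) f) g := by
  have h := (Equiv.addRight k).hasSum_iff.2 (lp.hasSum_inner (𝕜 := ℂ) (shift (-k) f) g)
  refine (lp.hasSum_inner (𝕜 := ℂ) f (shift k g)).unique ?_
  convert h using 2 with n
  simp

/-- The discrete Laplacian generates a norm-preserving flow: `i Δ_d` is skew-adjoint. -/
theorem re_inner_I_smul_laplacian (W : l2Z) :
    (inner ℂ W (Complex.I • (shift 1 W + shift (-1) W - (2 : ℂ) • W))).re = 0 := by
  have h1 : inner ℂ W (shift (-1) W) = conj (inner ℂ W (shift 1 W)) := by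
    rw [inner_shift, neg_neg, inner_conj_symm]
  have h2 : (inner ℂ W W : ℂ).im = 0 := inner_self_im (𝕜 := ℂ) W
  rw [inner_smul_right, inner_sub_right, inner_add_right, inner_smul_right, h1]
  simp only [Complex.I_mul_re, Complex.sub_im, Complex.add_im, Complex.mul_im, Complex.conj_im, h2,
    Complex.re_ofNat, Complex.im_ofNat]
  ring

/-- Multiplication by `i` times a real sequence is skew-adjoint. -/
theorem re_inner_I_smul_of_real_mul (W Z : l2Z) (p : ℤ → ℝ) (hZ : ∀ n, Z n = p n * W n) :
    (inner ℂ W (Complex.I • Z)).re = 0 := by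
  have h := Complex.hasSum_re (lp.hasSum_inner (𝕜 := ℂ) W (Complex.I • Z))
  refine h.unique ?_
  convert hasSum_zero using 2 with n
  simp [hZ]
  ring

end l2Z

open l2Z

theorem abs_norm_add_sq_sub_sq_le {q : ℝ} {c : ℂ} (hc : ‖c‖ = q) (v : ℂ) :
    |‖v + c‖ ^ 2 - q ^ 2| ≤ (2 * q + ‖v‖) * ‖v‖ := by
  have h1 : |‖v + c‖ - ‖c‖| ≤ ‖v‖ := by simpa using abs_norm_sub_norm_le (v + c) c
  have h2 := norm_add_le v c
  have hq : 0 ≤ q := hc ▸ norm_nonneg c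
  rw [hc] at h1 h2
  rw [show ‖v + c‖ ^ 2 - q ^ 2 = (‖v + c‖ + q) * (‖v + c‖ - q) by ring, abs_mul,
    abs_of_nonneg (by positivity)]
  exact mul_le_mul (by linarith) h1 (abs_nonneg _) (by positivity)

theorem F_AL_const_eq {q : ℝ} {c : ℂ} (hc : ‖c‖ = q) (U : ℤ → ℂ) (n : ℤ) :
    F_AL q c c U n = (q : ℂ) ^ 2 * (U (n + 1) + U (n - 1)) + (2 * c ^ 2 * conj (U n)
      + ((c * conj (U n) + conj c * U n) * (U (n + 1) + U (n - 1)) + 2 * c * (U n * conj (U n)))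
      + U n * conj (U n) * (U (n + 1) + U (n - 1))) := by
  have hq : (q : ℂ) ^ 2 = c * conj c := by rw [Complex.mul_conj', hc]
  simp only [F_AL, stepBg, ite_self, ← Complex.mul_conj', hq, map_add]
  ring

/-- For a constant background, the Ablowitz–Ladik nonlinearity differs from `q²(U_{n+1}+U_{n-1})`
by a sequence controlled pointwise by `U`. -/
theorem norm_F_AL_const_sub_le {q : ℝ} {c : ℂ} (hc : ‖c‖ = q) (U : l2Z) (n : ℤ) :
    ‖F_AL q c c U n - (q : ℂ) ^ 2 * (U (n + 1) + U (n - 1))‖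
      ≤ (2 * q ^ 2 + 7 / 2 * q * ‖U‖ + 5 / 7 * ‖U‖ ^ 2) * ‖U n‖ := by
  have hq : 0 ≤ q := hc ▸ norm_nonneg c
  have h3 := U.norm_sq_neighbors_le n
  have hs := norm_add_le (U (n + 1)) (U (n - 1))
  rw [F_AL_const_eq hc, add_sub_cancel_left]
  generalize U n = u at *
  generalize U (n + 1) = u₁ at *
  generalize U (n - 1) = u₂ at *
  have ha := norm_nonneg U
  generalize ‖U‖ = a at *
  have h4 : ‖u₁ + u₂‖ + ‖u‖ ≤ 7 / 4 * a := by
    have : ‖u₁‖ + ‖u₂‖ + ‖u‖ ≤ 7 / 4 * a := by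
      refine abs_le_of_sq_le_sq' ?_ (by positivity) |>.2
      nlinarith [sq_nonneg (‖u₁‖ - ‖u₂‖), sq_nonneg (‖u₁‖ - ‖u‖), sq_nonneg (‖u‖ - ‖u₂‖)]
    linarith
  have h5 : ‖u‖ * ‖u₁ + u₂‖ ≤ 5 / 7 * a ^ 2 := by
    have : ‖u‖ * (‖u₁‖ + ‖u₂‖) ≤ 5 / 7 * a ^ 2 := by
      nlinarith [sq_nonneg (‖u₁‖ - ‖u₂‖), sq_nonneg (‖u‖ - 5 / 7 * (‖u₁‖ + ‖u₂‖))]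
    exact (mul_le_mul_of_nonneg_left hs (norm_nonneg u)).trans this
  have hr : ‖c * conj u + conj c * u‖ ≤ 2 * q * ‖u‖ := by
    refine (norm_add_le _ _).trans (le_of_eq ?_)
    simp [hc]
    ring
  calc _ ≤ ‖2 * c ^ 2 * conj u‖ + (‖(c * conj u + conj c * u) * (u₁ + u₂)‖
        + ‖2 * c * (u * conj u)‖) + ‖u * conj u * (u₁ + u₂)‖ :=
      norm_add_le_of_le (norm_add_le_of_le le_rfl (norm_add_le _ _)) le_rfl
    _ ≤ 2 * q ^ 2 * ‖u‖ + (2 * q * ‖u‖ * ‖u₁ + u₂‖ + 2 * q * (‖u‖ * ‖u‖))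
        + ‖u‖ * ‖u‖ * ‖u₁ + u₂‖ := by
      have : ‖(c * conj u + conj c * u) * (u₁ + u₂)‖ ≤ 2 * q * ‖u‖ * ‖u₁ + u₂‖ := by
        rw [norm_mul]; gcongr
      have e : ‖2 * c ^ 2 * conj u‖ = 2 * q ^ 2 * ‖u‖ := by simp [hc]
      have e' : ‖2 * c * (u * conj u)‖ = 2 * q * (‖u‖ * ‖u‖) := by simp [hc]
      have e'' : ‖u * conj u * (u₁ + u₂)‖ = ‖u‖ * ‖u‖ * ‖u₁ + u₂‖ := by simp
      rw [e, e', e'']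
      linarith
    _ ≤ _ := by
      have := mul_le_mul_of_nonneg_left h4 (mul_nonneg hq (norm_nonneg u))
      have := mul_le_mul_of_nonneg_left h5 (norm_nonneg u)
      nlinarith

/-- The `ℓ²` bound on the Ablowitz–Ladik nonlinearity over a constant background. -/
theorem exists_F_AL_const {q : ℝ} {c : ℂ} (hc : ‖c‖ = q) (U : l2Z) :
    ∃ A : l2Z, (∀ n, A n = F_AL q c c U n) ∧
      ‖A‖ ≤ (4 * q ^ 2 + 7 / 2 * q * ‖U‖ + 5 / 7 * ‖U‖ ^ 2) * ‖U‖ := by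
  have hq : 0 ≤ q := hc ▸ norm_nonneg c
  obtain ⟨R, hR, hRn⟩ := exists_coe_eq_of_norm_le
    (fun n => F_AL q c c U n - (q : ℂ) ^ 2 * (U (n + 1) + U (n - 1))) U
    (by positivity) (norm_F_AL_const_sub_le hc U)
  refine ⟨(q : ℂ) ^ 2 • (shift 1 U + shift (-1) U) + R, fun n => ?_, ?_⟩
  · simp only [lp.coeFn_add, lp.coeFn_smul, Pi.add_apply, Pi.smul_apply, smul_eq_mul, shift_apply,
      hR, ← sub_eq_add_neg]
    ring
  · calc _ ≤ ‖(q : ℂ) ^ 2 • (shift 1 U + shift (-1) U)‖ + ‖R‖ := norm_add_le _ _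
      _ ≤ q ^ 2 * (‖U‖ + ‖U‖) + ‖R‖ := by
        rw [norm_smul]
        have := norm_add_le (shift 1 U) (shift (-1) U)
        rw [norm_shift, norm_shift] at this
        simp only [norm_pow, Complex.norm_real, Real.norm_of_nonneg hq]
        gcongr
      _ ≤ _ := by linarith

theorem growth_rate_ineq {a b q : ℝ} (ha : 0 ≤ a) (hb : 0 ≤ b) (hq : 0 ≤ q) :
    (4 * q ^ 2 + 7 / 2 * q * a + 5 / 7 * a ^ 2) * a
        + (2 * q * (2 * q + b) * b + 2 * ((2 * q + b) * b) * min a b)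
      ≤ 2 * a ^ 3 + b ^ 3 + (6 * a ^ 2 + 3 * b ^ 2) * q + (8 * a + 4 * b) * q ^ 2 := by
  rcases le_total a b with h | h
  · rw [min_eq_left h]
    obtain ⟨d, rfl⟩ := exists_add_of_le h
    have hd : 0 ≤ d := by linarith
    have h1 : 0 ≤ a * (q - a / 16 - d / 4) ^ 2 := by positivity
    have h2 : 0 ≤ q * d ^ 2 := by positivity
    have h3 : 0 ≤ (d + 4 / 5 * a) * (d - 2 / 5 * a) ^ 2 := by positivity
    have h4 : 0 ≤ a * (d - 2 / 5 * a) ^ 2 := by positivity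
    have h5 : 0 ≤ a ^ 2 * d := by positivity
    have h6 : 0 ≤ a ^ 3 := by positivity
    nlinarith
  · rw [min_eq_right h]
    obtain ⟨d, rfl⟩ := exists_add_of_le h
    have hd : 0 ≤ d := by linarith
    have h1 : 0 ≤ b * (q - b / 8) ^ 2 := by positivity
    have h2 : 0 ≤ d * q ^ 2 := by positivity
    have h3 : 0 ≤ q * d ^ 2 := by positivity
    have h4 : 0 ≤ q * b * d := by positivity
    have h5 : 0 ≤ b ^ 2 * d := by positivity
    have h6 : 0 ≤ b ^ 3 := by positivity
    have h7 : 0 ≤ d ^ 2 * b := by positivity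
    have h8 : 0 ≤ d ^ 3 := by positivity
    nlinarith

/-- Splitting of the difference of the two nonlinearities into a part of controlled `ℓ²` norm and
a real multiple of the difference `U - V`. -/
theorem exists_nonlinearity_splitting {q : ℝ} {c : ℂ} (hc : ‖c‖ = q) (U V : l2Z) :
    ∃ H Z : l2Z, (∀ n, H n + Z n = F_AL q c c U n - F_DNLS q c c V n) ∧
      (inner ℂ (U - V) (Complex.I • Z)).re = 0 ∧
      ‖H‖ ≤ 2 * ‖U‖ ^ 3 + ‖V‖ ^ 3 + (6 * ‖U‖ ^ 2 + 3 * ‖V‖ ^ 2) * q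
        + (8 * ‖U‖ + 4 * ‖V‖) * q ^ 2 := by
  have hq : 0 ≤ q := hc ▸ norm_nonneg c
  obtain ⟨A, hA, hAn⟩ := exists_F_AL_const hc U
  set p : ℤ → ℝ := fun n => ‖V n + c‖ ^ 2 - q ^ 2 with hp
  have hp1 : ∀ n, |p n| ≤ (2 * q + ‖V‖) * ‖V n‖ := fun n =>
    (abs_norm_add_sq_sub_sq_le hc (V n)).trans (by have := V.norm_apply_le n; gcongr)
  have hp2 : ∀ n, |p n| ≤ (2 * q + ‖V‖) * ‖V‖ := fun n =>
    (hp1 n).trans (by have := V.norm_apply_le n; gcongr)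
  obtain ⟨B, hB, hBn⟩ := exists_coe_eq_of_norm_le (fun n => 2 * (p n : ℂ) * c) V
    (C := 2 * q * (2 * q + ‖V‖)) (by positivity) (fun n => by
      have := mul_le_mul_of_nonneg_left (hp1 n) hq
      simp only [norm_mul, Complex.norm_real, Real.norm_eq_abs, hc, Complex.norm_ofNat]
      linarith)
  have hmul : ∀ X : l2Z, ∃ F : l2Z, (∀ n, F n = 2 * (p n : ℂ) * X n) ∧
      ‖F‖ ≤ 2 * ((2 * q + ‖V‖) * ‖V‖) * ‖X‖ := fun X =>
    exists_coe_eq_of_norm_le _ X (by positivity) (fun n => by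
      have := hp2 n
      simp only [norm_mul, Complex.norm_real, Real.norm_eq_abs, Complex.norm_ofNat]
      gcongr)
  have key := growth_rate_ineq (norm_nonneg U) (norm_nonneg V) hq
  have hD : ∀ n, F_DNLS q c c V n = 2 * (p n : ℂ) * V n + 2 * (p n : ℂ) * c := fun n => by
    simp only [F_DNLS, stepBg, ite_self, hp]
    push_cast
    ring
  rcases le_total ‖U‖ ‖V‖ with h | h
  · obtain ⟨M, hM, hMn⟩ := hmul U
    obtain ⟨Z, hZ, -⟩ := hmul (U - V)
    rw [min_eq_left h] at key
    refine ⟨A - (B + M), Z, fun n => ?_, ?_, ?_⟩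
    · simp [hA, hB, hM, hZ, hD]
      ring
    · exact re_inner_I_smul_of_real_mul _ _ (fun n => 2 * p n) (fun n => by simp [hZ])
    · linarith [norm_sub_le A (B + M), norm_add_le B M]
  · obtain ⟨M, hM, hMn⟩ := hmul V
    rw [min_eq_right h] at key
    refine ⟨A - (B + M), 0, fun n => ?_, by simp, ?_⟩
    · simp [hA, hB, hM, hD]
      ring
    · linarith [norm_sub_le A (B + M), norm_add_le B M]

/-- A Gronwall-type estimate: in a complex inner product space, a bound
`Re ⟪W, W'⟫ ≤ K ‖W‖` yields linear growth of `‖W‖`. -/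
theorem norm_le_add_mul_of_re_inner_le {E : Type*} [NormedAddCommGroup E] [InnerProductSpace ℂ E]
    [NormedSpace ℝ E] {W W' : ℝ → E} {C K T : ℝ} (hC : 0 < C) (hK : 0 ≤ K)
    (hW : ∀ t ∈ Set.Icc 0 T, HasDerivWithinAt W (W' t) (Set.Icc 0 T) t) (h0 : ‖W 0‖ ≤ C)
    (hb : ∀ t ∈ Set.Icc 0 T, (inner ℂ (W t) (W' t)).re ≤ K * ‖W t‖) :
    ∀ t ∈ Set.Icc 0 T, ‖W t‖ ≤ C + K * t := by
  have hsq : ∀ t, ‖W t‖ ^ 2 = (inner ℂ (W t) (W t)).re := fun t =>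
    norm_sq_eq_re_inner (𝕜 := ℂ) (W t)
  have hderiv : ∀ t ∈ Set.Icc 0 T,
      HasDerivWithinAt (fun s => ‖W s‖ ^ 2) (2 * (inner ℂ (W t) (W' t)).re) (Set.Icc 0 T) t := by
    intro t ht
    have h := Complex.reCLM.hasFDerivAt.comp_hasDerivWithinAt t ((hW t ht).inner ℂ (hW t ht))
    rw [← inner_conj_symm (W' t) (W t)] at h
    simp only [hsq]
    refine h.congr_deriv ?_
    simp only [Complex.reCLM_apply, Complex.add_re, Complex.conj_re]
    ring
  have main : ∀ K', K < K' → ∀ t ∈ Set.Icc 0 T, ‖W t‖ ≤ C + K' * t := by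
    intro K' hK' t ht
    have hle : ‖W t‖ ^ 2 ≤ (C + K' * t) ^ 2 := by
      refine image_le_of_deriv_right_lt_deriv_boundary (f := fun s => ‖W s‖ ^ 2)
        (f' := fun s => 2 * (inner ℂ (W s) (W' s)).re) (B := fun s => (C + K' * s) ^ 2)
        (B' := fun s => 2 * (C + K' * s) * K')
        (fun s hs => (hderiv s hs).continuousWithinAt)
        (fun s hs => (hderiv s (Set.Ico_subset_Icc_self hs)).mono_of_mem_nhdsWithin
          (Icc_mem_nhdsGE_of_mem hs)) ?_ ?_ ?_ ht
      · simpa using pow_le_pow_left₀ (norm_nonneg _) h0 2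
      · intro s
        have := (((hasDerivAt_id s).const_mul K').const_add C).pow 2
        refine this.congr_deriv ?_
        simp
      · intro s hs he
        have hpos : 0 < C + K' * s := by
          have := hs.1
          have : 0 ≤ K' := hK.trans hK'.le
          positivity
        have he' : ‖W s‖ = C + K' * s :=
          (pow_left_inj₀ (norm_nonneg _) hpos.le two_ne_zero).1 he
        have := hb s (Set.Ico_subset_Icc_self hs)
        rw [he'] at this
        nlinarith
    have : 0 ≤ K' * t := mul_nonneg (hK.trans hK'.le) ht.1
    exact abs_le_of_sq_le_sq' hle (by positivity) |>.2
  intro t ht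
  refine le_of_forall_pos_le_add fun δ hδ => ?_
  have h1 : 0 < t + 1 := by linarith [ht.1]
  refine (main (K + δ / (t + 1)) (by linarith [div_pos hδ h1]) t ht).trans ?_
  have : δ / (t + 1) * t ≤ δ := by
    rw [div_mul_eq_mul_div, div_le_iff₀ h1]
    nlinarith
  linarith

/-- Along a pair of solutions over a constant background, `Re ⟪U - V, U' - V'⟫` only sees the
difference of the nonlinearities. -/
theorem re_inner_sub_le_of_equations {κ q : ℝ} {c : ℂ} (hc : ‖c‖ = q) {U V U' V' : l2Z}
    (hU : ∀ n : ℤ, Complex.I * U' n + (κ : ℂ) * discLap U n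
      + (κ : ℂ) * discLap (stepBg c c) n + F_AL q c c U n = 0)
    (hV : ∀ n : ℤ, Complex.I * V' n + (κ : ℂ) * discLap V n
      + (κ : ℂ) * discLap (stepBg c c) n + F_DNLS q c c V n = 0) :
    (inner ℂ (U - V) (U' - V')).re ≤ (2 * ‖U‖ ^ 3 + ‖V‖ ^ 3 + (6 * ‖U‖ ^ 2 + 3 * ‖V‖ ^ 2) * q
      + (8 * ‖U‖ + 4 * ‖V‖) * q ^ 2) * ‖U - V‖ := by
  obtain ⟨H, Z, hHZ, hZ, hH⟩ := exists_nonlinearity_splitting hc U V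
  set W := U - V with hW
  have hW' : U' - V' = (κ : ℂ) • (Complex.I • (shift 1 W + shift (-1) W - (2 : ℂ) • W))
      + Complex.I • H + Complex.I • Z := by
    ext n
    simp only [hW, lp.coeFn_sub, lp.coeFn_add, lp.coeFn_smul, Pi.sub_apply, Pi.add_apply,
      Pi.smul_apply, smul_eq_mul, shift_apply, ← sub_eq_add_neg]
    have h1 := hU n
    have h2 := hV n
    have h3 := hHZ n
    simp only [discLap] at h1 h2
    linear_combination (-Complex.I) * h1 + Complex.I * h2 - Complex.I * h3
      + (U' n - V' n) * Complex.I_sq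
  have hlap := re_inner_I_smul_laplacian W
  have hHW : (inner ℂ W (Complex.I • H)).re ≤ ‖W‖ * ‖H‖ := by
    refine (Complex.re_le_norm _).trans ((norm_inner_le_norm _ _).trans (le_of_eq ?_))
    simp [norm_smul]
  rw [hW', inner_add_right, inner_add_right, inner_smul_right, Complex.add_re, Complex.add_re,
    Complex.re_ofReal_mul, hlap, hZ]
  have := mul_le_mul_of_nonneg_left hH (norm_nonneg W)
  linarith

/-- explicit linear-in-time proximity bound for a constant background
`q_+ = q_-`. -/
theorem dist_linear_growth_constant_background
    (κ q Tc : ℝ) (hκ : 0 < κ) (hq : 0 < q) (qm qp : ℂ) (hqm : ‖qm‖ = q) (hqp : ‖qp‖ = q)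
    (hconst : qp = qm)
    (ε : ℝ) (hε0 : 0 < ε) (hε1 : ε < 1)
    (C₃ C₅ C₆ : ℝ) (hC₃ : 0 < C₃) (hC₅ : 0 < C₅) (hC₆ : 0 < C₆)
    (U V : ℝ → l2Z)
    (hU : IsModALSol κ q qm qp Tc U) (hV : IsModDNLSSol κ q qm qp Tc V)
    (hdist0 : ‖U 0 - V 0‖ ≤ C₃ * ε ^ 3)
    (hUb : ∀ t ∈ Set.Icc (0:ℝ) Tc, ‖U t‖ ≤ C₅ * ε)
    (hVb : ∀ t ∈ Set.Icc (0:ℝ) Tc, ‖V t‖ ≤ C₆ * ε) :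
    ∀ t ∈ Set.Icc (0:ℝ) Tc,
      ‖U t - V t‖
        ≤ C₃ * ε ^ 3
          + ((2 * C₅ ^ 3 + C₆ ^ 3) * ε ^ 3 + (6 * C₅ ^ 2 + 3 * C₆ ^ 2) * q * ε ^ 2
              + (8 * C₅ + 4 * C₆) * q ^ 2 * ε) * t := by
  subst hconst
  obtain ⟨U', -, hU', hUe⟩ := hU
  obtain ⟨V', -, hV', hVe⟩ := hV
  refine norm_le_add_mul_of_re_inner_le (W := fun t => U t - V t) (W' := fun t => U' t - V' t)
    (by positivity) (by positivity) (fun t ht => (hU' t ht).sub (hV' t ht)) hdist0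
    (fun t ht => ?_)
  refine (re_inner_sub_le_of_equations hqm (hUe t ht) (hVe t ht)).trans ?_
  refine mul_le_mul_of_nonneg_right ?_ (norm_nonneg _)
  have h1 := hUb t ht
  have h2 := hVb t ht
  calc _ ≤ 2 * (C₅ * ε) ^ 3 + (C₆ * ε) ^ 3 + (6 * (C₅ * ε) ^ 2 + 3 * (C₆ * ε) ^ 2) * q
        + (8 * (C₅ * ε) + 4 * (C₆ * ε)) * q ^ 2 := by gcongr
    _ = _ := by ring
end
end

section
/- For every initial datum U⁰ ∈ ℓ²(ℤ;ℂ), there exists T > 0 such that the Cauchy problem for the modified Ablowitz–Ladik equation has a solution U : [0,T] → ℓ²(ℤ;ℂ) with U(0) = U⁰ that is continuously differentiable as a map into ℓ²(ℤ;ℂ), and this solution is unique: any two continuously differentiable ℓ²-valued solutions on [0,T] with the same initial datum U⁰ coincide. -/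
noncomputable section

lemma l2Z_hasSum_sq (W : l2Z) : HasSum (fun n : ℤ => ‖W n‖ ^ 2) (‖W‖ ^ 2) := by
  simpa using lp.hasSum_norm (p := 2) (by simp) W

lemma l2Z_norm_apply_le (W : l2Z) (n : ℤ) : ‖W n‖ ≤ ‖W‖ :=
  lp.norm_apply_le_norm two_ne_zero W n

/-- A sequence dominated by a three-point stencil of an `ℓ²` sequence: the sum of the shifted
squares. -/
lemma hasSum_stencil_sq (W : l2Z) (C : ℝ) :
    HasSum (fun n : ℤ => 3 * C ^ 2 * (‖W (n + 1)‖ ^ 2 + ‖W n‖ ^ 2 + ‖W (n - 1)‖ ^ 2))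
      ((3 * C * ‖W‖) ^ 2) := by
  have h := l2Z_hasSum_sq W
  have h₁ := (Equiv.addRight (1 : ℤ)).hasSum_iff.mpr h
  have h₂ := (Equiv.subRight (1 : ℤ)).hasSum_iff.mpr h
  simp only [Function.comp_def, Equiv.coe_addRight, Equiv.subRight_apply] at h₁ h₂
  rw [show (3 * C * ‖W‖) ^ 2 = 3 * C ^ 2 * (‖W‖ ^ 2 + ‖W‖ ^ 2 + ‖W‖ ^ 2) by ring]
  exact ((h₁.add h).add h₂).mul_left (3 * C ^ 2)

lemma sq_norm_le_stencil {f : ℤ → ℂ} {W : l2Z} {C : ℝ}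
    (h : ∀ n, ‖f n‖ ≤ C * (‖W (n + 1)‖ + ‖W n‖ + ‖W (n - 1)‖)) (n : ℤ) :
    ‖f n‖ ^ 2 ≤ 3 * C ^ 2 * (‖W (n + 1)‖ ^ 2 + ‖W n‖ ^ 2 + ‖W (n - 1)‖ ^ 2) := by
  refine (pow_le_pow_left₀ (norm_nonneg _) (h n) 2).trans ?_
  generalize ‖W (n + 1)‖ = a, ‖W n‖ = b, ‖W (n - 1)‖ = c
  have : (a + b + c) ^ 2 ≤ 3 * (a ^ 2 + b ^ 2 + c ^ 2) := by
    nlinarith [sq_nonneg (a - b), sq_nonneg (b - c), sq_nonneg (a - c)]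
  nlinarith [mul_le_mul_of_nonneg_left this (sq_nonneg C)]

lemma memℓp_of_stencil_bound {f : ℤ → ℂ} {W : l2Z} {C : ℝ}
    (h : ∀ n, ‖f n‖ ≤ C * (‖W (n + 1)‖ + ‖W n‖ + ‖W (n - 1)‖)) : Memℓp f 2 := by
  refine memℓp_gen ?_
  simpa using Summable.of_nonneg_of_le (fun n => sq_nonneg ‖f n‖) (sq_norm_le_stencil h)
    (hasSum_stencil_sq W C).summable

lemma norm_le_of_stencil_bound {f W : l2Z} {C : ℝ} (hC : 0 ≤ C)
    (h : ∀ n, ‖f n‖ ≤ C * (‖W (n + 1)‖ + ‖W n‖ + ‖W (n - 1)‖)) : ‖f‖ ≤ 3 * C * ‖W‖ :=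
  (sq_le_sq₀ (norm_nonneg _) (by positivity)).mp
    (hasSum_le (sq_norm_le_stencil h) (l2Z_hasSum_sq f) (hasSum_stencil_sq W C))

/-- The `n`-th coordinate of the right-hand side of the modified Ablowitz–Ladik equation, solved
for the time derivative. -/
def modALCoord (κ q : ℝ) (qm qp : ℂ) (U : ℤ → ℂ) (n : ℤ) : ℂ :=
  Complex.I * ((κ : ℂ) * discLap U n + (κ : ℂ) * discLap (stepBg qm qp) n + F_AL q qm qp U n)

/-- The Lipschitz constant of a coordinate of the vector field on the ball of radius `R`. -/
def modALConst (κ q R : ℝ) : ℝ := 2 * κ + 2 * q ^ 2 + 4 * (R + q) ^ 2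

lemma norm_stepBg {q : ℝ} {qm qp : ℂ} (hqm : ‖qm‖ = q) (hqp : ‖qp‖ = q) (n : ℤ) :
    ‖stepBg qm qp n‖ = q := by
  unfold stepBg
  split_ifs <;> assumption

lemma norm_sq_mul_sub_le {a b S S' : ℂ} {M : ℝ} (ha : ‖a‖ ≤ M) (hb : ‖b‖ ≤ M)
    (hS : ‖S'‖ ≤ 2 * M) :
    ‖(‖a‖ : ℂ) ^ 2 * S - (‖b‖ : ℂ) ^ 2 * S'‖ ≤ M ^ 2 * ‖S - S'‖ + 4 * M ^ 2 * ‖a - b‖ := by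
  have hM : 0 ≤ M := (norm_nonneg a).trans ha
  have e : (‖a‖ : ℂ) ^ 2 * S - (‖b‖ : ℂ) ^ 2 * S'
      = ((‖a‖ ^ 2 : ℝ) : ℂ) * (S - S') + (((‖a‖ + ‖b‖) * (‖a‖ - ‖b‖) : ℝ) : ℂ) * S' := by
    push_cast; ring
  rw [e]
  refine (norm_add_le _ _).trans ?_
  simp only [norm_mul, Complex.norm_real, Real.norm_eq_abs, abs_pow, abs_norm]
  refine add_le_add (by gcongr) ?_
  rw [abs_of_nonneg (by positivity : 0 ≤ ‖a‖ + ‖b‖)]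
  calc (‖a‖ + ‖b‖) * |‖a‖ - ‖b‖| * ‖S'‖ ≤ (M + M) * ‖a - b‖ * (2 * M) := by
        gcongr
        exact abs_norm_sub_norm_le a b
    _ = 4 * M ^ 2 * ‖a - b‖ := by ring

lemma norm_modALCoord_sub_le {κ q : ℝ} (hκ : 0 ≤ κ) {qm qp : ℂ} (hqm : ‖qm‖ = q)
    (hqp : ‖qp‖ = q) {U V : ℤ → ℂ} {R : ℝ} (hU : ∀ n, ‖U n‖ ≤ R) (hV : ∀ n, ‖V n‖ ≤ R) (n : ℤ) :
    ‖modALCoord κ q qm qp U n - modALCoord κ q qm qp V n‖ ≤ modALConst κ q R *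
      (‖U (n + 1) - V (n + 1)‖ + ‖U n - V n‖ + ‖U (n - 1) - V (n - 1)‖) := by
  have hs := norm_stepBg hqm hqp
  have hbd {X : ℤ → ℂ} (hX : ∀ n, ‖X n‖ ≤ R) (m : ℤ) : ‖X m + stepBg qm qp m‖ ≤ R + q :=
    (norm_add_le _ _).trans (add_le_add (hX m) (hs m).le)
  set SU := U (n + 1) + U (n - 1) + stepBg qm qp (n + 1) + stepBg qm qp (n - 1) with hSU
  set SV := V (n + 1) + V (n - 1) + stepBg qm qp (n + 1) + stepBg qm qp (n - 1) with hSV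
  have hSVle : ‖SV‖ ≤ 2 * (R + q) := by
    have := (norm_add_le _ _).trans (add_le_add (hbd hV (n + 1)) (hbd hV (n - 1)))
    rw [two_mul, hSV]
    convert! this using 2
    ring
  have hcub := norm_sq_mul_sub_le (S := SU) (hbd hU n) (hbd hV n) hSVle
  set x := U (n + 1) - V (n + 1) with hx
  set y := U n - V n with hy
  set z := U (n - 1) - V (n - 1) with hz
  rw [show SU - SV = x + z by rw [hSU, hSV, hx, hz]; ring,
    show U n + stepBg qm qp n - (V n + stepBg qm qp n) = y by rw [hy]; ring] at hcub
  have e : modALCoord κ q qm qp U n - modALCoord κ q qm qp V n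
      = Complex.I * ((κ : ℂ) * (x + z + (-2) * y) + (-(2 * (q : ℂ) ^ 2)) * y
        + ((‖U n + stepBg qm qp n‖ : ℂ) ^ 2 * SU - (‖V n + stepBg qm qp n‖ : ℂ) ^ 2 * SV)) := by
    simp only [modALCoord, discLap, F_AL, ← hSU, ← hSV, hx, hy, hz]
    ring
  have h₁ : ‖(κ : ℂ) * (x + z + (-2) * y)‖ ≤ κ * (‖x‖ + ‖z‖ + 2 * ‖y‖) := by
    rw [norm_mul, Complex.norm_real, Real.norm_of_nonneg hκ]
    gcongr
    refine (norm_add₃_le).trans ?_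
    simp
  have h₂ : ‖(-(2 * (q : ℂ) ^ 2)) * y‖ = 2 * q ^ 2 * ‖y‖ := by
    simp
  have h₃ : (R + q) ^ 2 * ‖x + z‖ ≤ (R + q) ^ 2 * (‖x‖ + ‖z‖) := by
    gcongr
    exact norm_add_le _ _
  rw [e, norm_mul, Complex.norm_I, one_mul, modALConst]
  refine norm_add₃_le.trans ?_
  rw [h₂]
  have p₁ := mul_nonneg hκ (norm_nonneg x)
  have p₂ := mul_nonneg hκ (norm_nonneg z)
  have p₃ := mul_nonneg (sq_nonneg q) (norm_nonneg x)
  have p₄ := mul_nonneg (sq_nonneg q) (norm_nonneg z)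
  have p₅ := mul_nonneg (sq_nonneg (R + q)) (norm_nonneg x)
  have p₆ := mul_nonneg (sq_nonneg (R + q)) (norm_nonneg z)
  linarith

lemma memℓp_modALCoord_zero {κ q : ℝ} {qm qp : ℂ} (hqm : ‖qm‖ = q) (hqp : ‖qp‖ = q) :
    Memℓp (modALCoord κ q qm qp 0) 2 := by
  refine memℓp_gen (summable_of_ne_finset_zero (s := {0, 1}) fun n hn => ?_)
  have hn' : n < 0 ∨ 1 < n := by
    simp only [Finset.mem_insert, Finset.mem_singleton] at hn
    omega
  have hc : stepBg qm qp (n + 1) = stepBg qm qp n ∧ stepBg qm qp (n - 1) = stepBg qm qp n := by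
    rcases hn' with h | h
    · simp [stepBg, show n + 1 ≤ 0 by omega, show n ≤ 0 by omega, show n ≤ 1 by omega]
    · simp [stepBg, show ¬ n + 1 ≤ 0 by omega, show ¬ n ≤ 0 by omega, show ¬ n ≤ 1 by omega]
  have hz : modALCoord κ q qm qp 0 n = 0 := by
    simp only [modALCoord, discLap, F_AL, hc.1, hc.2, Pi.zero_apply, zero_add,
      norm_stepBg hqm hqp]
    ring
  simp [hz]

lemma memℓp_modALCoord {κ q : ℝ} (hκ : 0 ≤ κ) {qm qp : ℂ} (hqm : ‖qm‖ = q) (hqp : ‖qp‖ = q)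
    (U : l2Z) : Memℓp (modALCoord κ q qm qp U) 2 := by
  have h : Memℓp (modALCoord κ q qm qp U - modALCoord κ q qm qp 0) 2 :=
    memℓp_of_stencil_bound (W := U) (C := modALConst κ q ‖U‖) fun n => by
      simpa using norm_modALCoord_sub_le hκ hqm hqp (l2Z_norm_apply_le U)
        (V := 0) (fun _ => by simp) n
  have h' := h.add (memℓp_modALCoord_zero (κ := κ) hqm hqp)
  rwa [sub_add_cancel] at h'

lemma exists_modAL_vectorField {κ q : ℝ} (hκ : 0 ≤ κ) {qm qp : ℂ} (hqm : ‖qm‖ = q)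
    (hqp : ‖qp‖ = q) :
    ∃ G : l2Z → l2Z, (∀ U n, G U n = modALCoord κ q qm qp U n) ∧
      ∀ R : ℝ, ∃ K : NNReal, LipschitzOnWith K G (Metric.closedBall 0 R) := by
  refine ⟨fun U => ⟨modALCoord κ q qm qp U, memℓp_modALCoord hκ hqm hqp U⟩, fun _ _ => rfl,
    fun R => ?_⟩
  have hC : 0 ≤ modALConst κ q R := by unfold modALConst; positivity
  refine ⟨⟨3 * modALConst κ q R, by positivity⟩, LipschitzOnWith.of_dist_le_mul
    fun U hU V hV => ?_⟩
  rw [mem_closedBall_zero_iff] at hU hV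
  rw [dist_eq_norm, dist_eq_norm]
  exact norm_le_of_stencil_bound hC fun n => norm_modALCoord_sub_le hκ hqm hqp
    (fun m => (l2Z_norm_apply_le U m).trans hU) (fun m => (l2Z_norm_apply_le V m).trans hV) n

section Autonomous

variable {E : Type*} [NormedAddCommGroup E] {G : E → E}

lemma continuous_of_lipschitzOnWith_closedBall
    (hG : ∀ R : ℝ, ∃ K : NNReal, LipschitzOnWith K G (Metric.closedBall 0 R)) :
    Continuous G := by
  refine continuous_iff_continuousAt.mpr fun x => ?_
  obtain ⟨K, hK⟩ := hG (‖x‖ + 1)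
  refine hK.continuousOn.continuousAt (Metric.closedBall_mem_nhds_of_mem ?_)
  simp

variable [NormedSpace ℝ E]

lemma exists_solution_of_lipschitzOnWith_closedBall [CompleteSpace E]
    (hG : ∀ R : ℝ, ∃ K : NNReal, LipschitzOnWith K G (Metric.closedBall 0 R)) (x₀ : E) :
    ∃ T : ℝ, 0 < T ∧ ∃ α : ℝ → E, α 0 = x₀ ∧
      ∀ t ∈ Set.Icc 0 T, HasDerivWithinAt α (G (α t)) (Set.Icc 0 T) t := by
  obtain ⟨K, hK⟩ := hG (‖x₀‖ + 1)
  have hK' : LipschitzOnWith K G (Metric.closedBall x₀ (1 : NNReal)) :=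
    hK.mono (Metric.closedBall_subset_closedBall' (by simp [add_comm]))
  let L : NNReal := ‖G x₀‖₊ + K
  have hb : ∀ x ∈ Metric.closedBall x₀ (1 : NNReal), ‖G x‖ ≤ L := fun x hx => by
    have h := hK'.dist_le_mul x hx x₀ (by simp)
    rw [dist_eq_norm] at h
    have h₁ : (K : ℝ) * dist x x₀ ≤ K * 1 := by
      gcongr
      simpa using hx
    have h₂ := norm_sub_norm_le (G x) (G x₀)
    simp only [L, NNReal.coe_add, coe_nnnorm]
    linarith
  have hT : (0 : ℝ) < 1 / (L + 1) := by positivity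
  refine ⟨1 / (L + 1), hT, ?_⟩
  have hPL : IsPicardLindelof (fun _ => G) (⟨0, le_rfl, hT.le⟩ : Set.Icc (0 : ℝ) (1 / (L + 1)))
      x₀ 1 0 L K := by
    refine .of_time_independent hb hK' ?_
    simp only [sub_zero, sub_self, max_eq_left hT.le, NNReal.coe_one, NNReal.coe_zero]
    rw [mul_one_div, div_le_one (by positivity)]
    linarith
  exact hPL.exists_eq_forall_mem_Icc_hasDerivWithinAt₀

lemma solution_unique_of_lipschitzOnWith_closedBall
    (hG : ∀ R : ℝ, ∃ K : NNReal, LipschitzOnWith K G (Metric.closedBall 0 R)) {T : ℝ}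
    {α β : ℝ → E} (h₀ : α 0 = β 0)
    (hα : ∀ t ∈ Set.Icc 0 T, HasDerivWithinAt α (G (α t)) (Set.Icc 0 T) t)
    (hβ : ∀ t ∈ Set.Icc 0 T, HasDerivWithinAt β (G (β t)) (Set.Icc 0 T) t) :
    Set.EqOn α β (Set.Icc 0 T) := by
  have cα : ContinuousOn α (Set.Icc 0 T) := fun t ht => (hα t ht).continuousWithinAt
  have cβ : ContinuousOn β (Set.Icc 0 T) := fun t ht => (hβ t ht).continuousWithinAt
  obtain ⟨A, hA⟩ := isCompact_Icc.exists_bound_of_continuousOn cα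
  obtain ⟨B, hB⟩ := isCompact_Icc.exists_bound_of_continuousOn cβ
  obtain ⟨K, hK⟩ := hG (max A B)
  have right {γ : ℝ → E} (hγ : ∀ t ∈ Set.Icc 0 T, HasDerivWithinAt γ (G (γ t)) (Set.Icc 0 T) t)
      (t : ℝ) (ht : t ∈ Set.Ico 0 T) : HasDerivWithinAt γ (G (γ t)) (Set.Ici t) t :=
    (hγ t (Set.Ico_subset_Icc_self ht)).mono_of_mem_nhdsWithin
      (Icc_mem_nhdsGE_of_mem ht)
  refine ODE_solution_unique_of_mem_Icc_right (v := fun _ => G)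
    (s := fun _ => Metric.closedBall 0 (max A B)) (fun _ _ => hK) cα (right hα) ?_ cβ
    (right hβ) ?_ h₀
  · intro t ht
    exact mem_closedBall_zero_iff.mpr
      ((hA t (Set.Ico_subset_Icc_self ht)).trans (le_max_left _ _))
  · intro t ht
    exact mem_closedBall_zero_iff.mpr
      ((hB t (Set.Ico_subset_Icc_self ht)).trans (le_max_right _ _))

end Autonomous

lemma isModALSol_iff {κ q : ℝ} {qm qp : ℂ} {G : l2Z → l2Z} (hGc : Continuous G)
    (hG : ∀ U n, G U n = modALCoord κ q qm qp U n) {T : ℝ} {U : ℝ → l2Z} :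
    IsModALSol κ q qm qp T U ↔
      ∀ t ∈ Set.Icc 0 T, HasDerivWithinAt U (G (U t)) (Set.Icc 0 T) t := by
  constructor
  · rintro ⟨U', -, hU', heq⟩ t ht
    convert! hU' t ht using 1
    ext n
    rw [hG, modALCoord]
    linear_combination Complex.I * heq t ht n - U' t n * Complex.I_sq
  · intro h
    refine ⟨fun t => G (U t), hGc.comp_continuousOn fun t ht => (h t ht).continuousWithinAt, h,
      fun t _ n => ?_⟩
    rw [hG, modALCoord, ← mul_assoc, Complex.I_mul_I]
    ring

/-- local existence and uniqueness for the Cauchy problem of the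
modified Ablowitz–Ladik equation in `ℓ²(ℤ;ℂ)`. -/
theorem modAL_local_wellposedness
    (κ q : ℝ) (hκ : 0 < κ) (hq : 0 < q) (qm qp : ℂ) (hqm : ‖qm‖ = q) (hqp : ‖qp‖ = q)
    (U0 : l2Z) :
    ∃ T : ℝ, 0 < T ∧
      (∃ U : ℝ → l2Z, IsModALSol κ q qm qp T U ∧ U 0 = U0) ∧
      (∀ U₁ U₂ : ℝ → l2Z,
        IsModALSol κ q qm qp T U₁ → IsModALSol κ q qm qp T U₂ →
        U₁ 0 = U0 → U₂ 0 = U0 →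
        ∀ t ∈ Set.Icc (0:ℝ) T, U₁ t = U₂ t) := by
  obtain ⟨G, hG, hlip⟩ := exists_modAL_vectorField hκ.le hqm hqp
  have hiff := fun T U => isModALSol_iff (T := T) (U := U)
    (continuous_of_lipschitzOnWith_closedBall hlip) hG
  obtain ⟨T, hT, U, hU0, hU⟩ := exists_solution_of_lipschitzOnWith_closedBall hlip U0
  refine ⟨T, hT, ⟨U, (hiff T U).mpr hU, hU0⟩, fun U₁ U₂ h₁ h₂ h₁0 h₂0 => ?_⟩
  exact solution_unique_of_lipschitzOnWith_closedBall hlip (h₁0.trans h₂0.symm)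
    ((hiff T U₁).mp h₁) ((hiff T U₂).mp h₂)
end
end
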